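/- Let h = (h¹,…,h⁴) be a centered Gaussian vector with covariance C having unit diagonal, and σ(x) = x + a(x² - 1). Then E[σ(h¹)σ(h²)σ(h³)σ(h⁴)] - (K₁₂K₃₄ + K₁₃K₂₄ + K₁₄K₂₃), where K_μν = C_μν + 2a²C_μν², equals 16a⁴(C₁₂C₁₃C₂₄C₃₄ + C₁₂C₁₄C₂₃C₃₄ + C₁₃C₁₄C₂₃C₂₄) + 4a²(C₁₂C₁₃C₂₄ + C₁₂C₁₃C₃₄ + C₁₂C₁₄C₂₃ + C₁₂C₁₄C₃₄ + C₁₂C₂₃C₃₄ + C₁₂C₂₄C₃₄ + C₁₃C₁₄C₂₃ + C₁₃C₁₄C₂₄ + C₁₃C₂₃C₂₄ + C₁₃C₂₄C₃₄ + C₁₄C₂₃C₂₄ + C₁₄C₂₃C₃₄). -/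

import Mathlib

open Real MeasureTheory Matrix

section Gaussian

variable {ι : Type*} [Fintype ι] [DecidableEq ι]

/-- The unnormalised density of the centred Gaussian vector with covariance matrix `C`. -/
noncomputable def gaussianWeight (C : Matrix ι ι ℝ) (x : ι → ℝ) : ℝ :=
  Real.exp (-(x ⬝ᵥ C⁻¹ *ᵥ x) / 2)

/-- The unnormalised Gaussian moment of a product of polynomials in the coordinates. -/
noncomputable def polyMoment (C : Matrix ι ι ℝ) (P : ι → Polynomial ℝ) : ℝ :=
  ∫ x : ι → ℝ, (∏ i, (P i).eval (x i)) * gaussianWeight C x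

lemma dotProduct_inv_mulVec_col {C : Matrix ι ι ℝ} (hC : C.PosDef) (x : ι → ℝ) (i : ι) :
    x ⬝ᵥ C⁻¹ *ᵥ C.col i = x i := by
  have hu : IsUnit C.det := (ne_of_gt hC.det_pos).isUnit
  rw [← mulVec_single_one C i, mulVec_mulVec, nonsing_inv_mul _ hu, one_mulVec,
    dotProduct_single_one]

lemma col_dotProduct_inv_mulVec {C : Matrix ι ι ℝ} (hC : C.PosDef) (x : ι → ℝ) (i : ι) :
    C.col i ⬝ᵥ C⁻¹ *ᵥ x = x i := by
  have hs : (C⁻¹)ᵀ = C⁻¹ := by simpa using hC.inv.isHermitian.eq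
  rw [dotProduct_mulVec, ← mulVec_transpose, hs, dotProduct_comm, dotProduct_inv_mulVec_col hC]

lemma quadForm_add_smul_col {C : Matrix ι ι ℝ} (hC : C.PosDef) (x : ι → ℝ) (i : ι) (t : ℝ) :
    (x + t • C.col i) ⬝ᵥ C⁻¹ *ᵥ (x + t • C.col i) =
      x ⬝ᵥ C⁻¹ *ᵥ x + 2 * t * x i + t ^ 2 * C i i := by
  simp only [mulVec_add, mulVec_smul, dotProduct_add, add_dotProduct, dotProduct_smul,
    smul_dotProduct, dotProduct_inv_mulVec_col hC, col_dotProduct_inv_mulVec hC, smul_eq_mul,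
    Pi.add_apply, Pi.smul_apply, col_apply]
  ring

lemma quadForm_nonneg {C : Matrix ι ι ℝ} (hC : C.PosDef) (x : ι → ℝ) :
    0 ≤ x ⬝ᵥ C⁻¹ *ᵥ x := by
  simpa using hC.inv.posSemidef.dotProduct_mulVec_nonneg x

lemma sq_le_diag_mul_quadForm {C : Matrix ι ι ℝ} (hC : C.PosDef) (x : ι → ℝ) (i : ι) :
    x i ^ 2 ≤ C i i * (x ⬝ᵥ C⁻¹ *ᵥ x) := by
  have h0 : 0 < C i i := hC.diag_pos
  have h := quadForm_nonneg hC (x + (-(x i / C i i)) • C.col i)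
  rw [quadForm_add_smul_col hC] at h
  have h2 := mul_nonneg h0.le h
  have h3 : C i i * (x ⬝ᵥ C⁻¹ *ᵥ x + 2 * -(x i / C i i) * x i + (-(x i / C i i)) ^ 2 * C i i) =
      C i i * (x ⬝ᵥ C⁻¹ *ᵥ x) - x i ^ 2 := by
    field_simp
    ring
  linarith

lemma exists_gaussianWeight_le {C : Matrix ι ι ℝ} (hC : C.PosDef) :
    ∃ b > 0, ∀ x : ι → ℝ, gaussianWeight C x ≤ ∏ i, Real.exp (-b * x i ^ 2) := by
  have hT : 0 ≤ C.trace := hC.posSemidef.trace_nonneg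
  refine ⟨1 / (2 * (C.trace + 1)), by positivity, fun x => ?_⟩
  rw [← Real.exp_sum, gaussianWeight, Real.exp_le_exp, ← Finset.mul_sum]
  have h1 : ∑ i, x i ^ 2 ≤ C.trace * (x ⬝ᵥ C⁻¹ *ᵥ x) := by
    rw [trace, Finset.sum_mul]
    exact Finset.sum_le_sum fun i _ => sq_le_diag_mul_quadForm hC x i
  have h2 := quadForm_nonneg hC x
  have h3 : (∑ i, x i ^ 2) / (C.trace + 1) ≤ x ⬝ᵥ C⁻¹ *ᵥ x := by
    rw [div_le_iff₀ (by positivity)]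
    linarith
  have h4 : -(1 / (2 * (C.trace + 1))) * ∑ i, x i ^ 2 = -((∑ i, x i ^ 2) / (C.trace + 1)) / 2 := by
    field_simp
  rw [h4]
  linarith

lemma integrable_eval_mul_exp_neg_mul_sq {b : ℝ} (hb : 0 < b) (p : Polynomial ℝ) :
    Integrable fun x : ℝ => p.eval x * Real.exp (-b * x ^ 2) := by
  simp only [Polynomial.eval_eq_sum_range, Finset.sum_mul, mul_assoc]
  refine integrable_finsetSum _ fun k _ => Integrable.const_mul ?_ _
  simpa using integrable_rpow_mul_exp_neg_mul_sq hb (s := k)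
    (lt_of_lt_of_le neg_one_lt_zero k.cast_nonneg)

lemma continuous_gaussianWeight (C : Matrix ι ι ℝ) : Continuous (gaussianWeight C) := by
  unfold gaussianWeight
  fun_prop

lemma integrable_prod_eval_mul_gaussianWeight {C : Matrix ι ι ℝ} (hC : C.PosDef)
    (P : ι → Polynomial ℝ) :
    Integrable fun x : ι → ℝ => (∏ i, (P i).eval (x i)) * gaussianWeight C x := by
  obtain ⟨b, hb, hle⟩ := exists_gaussianWeight_le hC
  have hint : Integrable fun x : ι → ℝ => ∏ i, (P i).eval (x i) * Real.exp (-b * x i ^ 2) :=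
    Integrable.fintype_prod (f := fun i y => (P i).eval y * Real.exp (-b * y ^ 2))
      fun i => integrable_eval_mul_exp_neg_mul_sq hb (P i)
  refine hint.mono ?_ (Filter.Eventually.of_forall fun x => ?_)
  · have := continuous_gaussianWeight C
    exact Continuous.aestronglyMeasurable (by fun_prop)
  · rw [Finset.prod_mul_distrib, norm_mul, norm_mul]
    gcongr
    rw [Real.norm_of_nonneg (show 0 ≤ gaussianWeight C x from (Real.exp_pos _).le),
      Real.norm_of_nonneg (Finset.prod_nonneg fun i _ => (Real.exp_pos _).le)]
    exact hle x

lemma hasLineDerivAt_gaussianWeight_col {C : Matrix ι ι ℝ} (hC : C.PosDef) (x : ι → ℝ) (i : ι) :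
    HasLineDerivAt ℝ (gaussianWeight C) (-(x i) * gaussianWeight C x) x (C.col i) := by
  unfold HasLineDerivAt gaussianWeight
  simp only [quadForm_add_smul_col hC]
  have h : HasDerivAt (fun t : ℝ => -(x ⬝ᵥ C⁻¹ *ᵥ x + 2 * t * x i + t ^ 2 * C i i) / 2)
      (-(x i)) 0 := by
    have := (((((hasDerivAt_id (0 : ℝ)).const_mul 2).mul_const (x i)).const_add
      (x ⬝ᵥ C⁻¹ *ᵥ x)).add (((hasDerivAt_id (0 : ℝ)).pow 2).mul_const (C i i))).neg.div_const 2
    convert! this using 1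
    simp [mul_div_cancel_left₀, neg_div]
  simpa [mul_comm] using h.exp

lemma prod_eval_update (P : ι → Polynomial ℝ) (j : ι) (p : Polynomial ℝ) (x : ι → ℝ) :
    ∏ i, (Function.update P j p i).eval (x i) =
      p.eval (x j) * ∏ i ∈ Finset.univ.erase j, (P i).eval (x i) := by
  rw [← Finset.mul_prod_erase _ _ (Finset.mem_univ j), Function.update_self]
  congr 1
  exact Finset.prod_congr rfl fun k hk => by
    rw [Function.update_of_ne (Finset.ne_of_mem_erase hk)]

lemma hasLineDerivAt_prod_eval (P : ι → Polynomial ℝ) (x v : ι → ℝ) :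
    HasLineDerivAt ℝ (fun x : ι → ℝ => ∏ i, (P i).eval (x i))
      (∑ j, v j * ∏ i, (Function.update P j (P j).derivative i).eval (x i)) x v := by
  unfold HasLineDerivAt
  have h : ∀ i ∈ Finset.univ, HasDerivAt (fun t : ℝ => (P i).eval ((x + t • v) i))
      ((P i).derivative.eval (x i) * v i) 0 := by
    intro i _
    have h1 : HasDerivAt (fun t : ℝ => x i + t * v i) (v i) 0 := by
      simpa using ((hasDerivAt_id (0 : ℝ)).mul_const (v i)).const_add (x i)
    have h2 := (P i).hasDerivAt (x i + 0 * v i)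
    simpa [Function.comp_def] using! h2.comp 0 h1
  convert! HasDerivAt.fun_finsetProd h using 1
  refine Finset.sum_congr rfl fun j _ => ?_
  simp only [prod_eval_update, smul_eq_mul, zero_smul, add_zero]
  ring

/-- Gaussian integration by parts. -/
lemma polyMoment_update_X_mul {C : Matrix ι ι ℝ} (hC : C.PosDef) (P : ι → Polynomial ℝ) (i : ι) :
    polyMoment C (Function.update P i (Polynomial.X * P i)) =
      ∑ j, C i j * polyMoment C (Function.update P j (P j).derivative) := by
  have hX (x : ι → ℝ) : ∏ k, (Function.update P i (Polynomial.X * P i) k).eval (x k) =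
      x i * ∏ k, (P k).eval (x k) := by
    rw [prod_eval_update, Polynomial.eval_mul, Polynomial.eval_X, mul_assoc,
      Finset.mul_prod_erase _ (fun k => (P k).eval (x k)) (Finset.mem_univ i)]
  have hI := integrable_prod_eval_mul_gaussianWeight hC (Function.update P i (Polynomial.X * P i))
  have hD (j : ι) := integrable_prod_eval_mul_gaussianWeight hC
    (Function.update P j (P j).derivative)
  have key := integral_bilinear_hasLineDerivAt_right_eq_neg_left_of_integrable
    (μ := (volume : Measure (ι → ℝ))) (B := ContinuousLinearMap.mul ℝ ℝ) (v := C.col i)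
    (f := fun x : ι → ℝ => ∏ k, (P k).eval (x k)) (g := gaussianWeight C)
    (g' := fun x => -(x i) * gaussianWeight C x)
    (f' := fun x => ∑ j, C.col i j * ∏ k, (Function.update P j (P j).derivative k).eval (x k))
    (by
      simp only [ContinuousLinearMap.mul_apply', Finset.sum_mul, mul_assoc]
      exact integrable_finsetSum _ fun j _ => (hD j).const_mul _)
    (by
      refine hI.neg.congr (Filter.Eventually.of_forall fun x => ?_)
      simp only [ContinuousLinearMap.mul_apply', Pi.neg_apply, hX]
      ring)
    (integrable_prod_eval_mul_gaussianWeight hC P)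
    (fun x _ => hasLineDerivAt_prod_eval P x _)
    (fun x _ => hasLineDerivAt_gaussianWeight_col hC x i)
  simp only [ContinuousLinearMap.mul_apply', Finset.sum_mul, mul_assoc] at key
  rw [integral_finsetSum _ fun j _ => (hD j).const_mul _] at key
  simp only [integral_const_mul] at key
  have hsymm (j : ι) : C.col i j = C i j := by
    simpa using hC.isHermitian.apply i j
  simp only [hsymm] at key
  unfold polyMoment
  rw [← neg_inj, ← key, ← integral_neg]
  refine integral_congr_ae (Filter.Eventually.of_forall fun x => ?_)
  simp only [hX]
  ring

open scoped MatrixOrder Matrix.Norms.L2Operator in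
lemma PosSemidef.exists_eq_transpose_mul_self {A : Matrix ι ι ℝ} (hA : A.PosSemidef) :
    ∃ B : Matrix ι ι ℝ, A = Bᵀ * B := by
  obtain ⟨B, hB⟩ := CStarAlgebra.nonneg_iff_eq_star_mul_self.mp hA.nonneg
  exact ⟨B, by rw [hB, star_eq_conjTranspose, conjTranspose_eq_transpose_of_trivial]⟩

lemma integral_gaussianWeight {C : Matrix ι ι ℝ} (hC : C.PosDef) :
    ∫ x : ι → ℝ, gaussianWeight C x = √((2 * π) ^ Fintype.card ι * C.det) := by
  obtain ⟨B, hB⟩ := PosSemidef.exists_eq_transpose_mul_self hC.inv.posSemidef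
  have hdet : B.det ^ 2 = C.det⁻¹ := by
    have := congrArg det hB
    rw [det_nonsing_inv, Ring.inverse_eq_inv', det_mul, det_transpose] at this
    rw [this, sq]
  have hCdet := hC.det_pos
  have hB0 : B.det ≠ 0 := by
    intro h
    rw [h, zero_pow two_ne_zero] at hdet
    exact (inv_pos.mpr hCdet).ne hdet
  have hw (x : ι → ℝ) : gaussianWeight C x =
      (fun z : ι → ℝ => ∏ i, Real.exp (-(1 / 2) * z i ^ 2)) (toLin' B x) := by
    have hq : x ⬝ᵥ C⁻¹ *ᵥ x = ∑ i, (B *ᵥ x) i ^ 2 := by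
      rw [hB, ← mulVec_mulVec, mulVec_transpose, dotProduct_comm, ← dotProduct_mulVec]
      simp [dotProduct, sq]
    simp only [gaussianWeight, hq, toLin'_apply, ← Real.exp_sum, ← Finset.mul_sum]
    congr 1
    ring
  simp only [hw]
  rw [← integral_map (μ := volume) (φ := toLin' B)
    (f := fun z : ι → ℝ => ∏ i, Real.exp (-(1 / 2) * z i ^ 2))
    (LinearMap.continuous_of_finiteDimensional _).aemeasurable
    (Continuous.aestronglyMeasurable (by fun_prop)),
    Real.map_matrix_volume_pi_eq_smul_volume_pi hB0, integral_smul_measure,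
    integral_fintype_prod_volume_eq_pow (fun z : ℝ => Real.exp (-(1 / 2) * z ^ 2)),
    integral_gaussian, ENNReal.toReal_ofReal (abs_nonneg _), smul_eq_mul]
  have h1 : |B.det⁻¹| = √C.det := by
    rw [← Real.sqrt_sq_eq_abs, inv_pow, hdet, inv_inv]
  rw [h1, Real.sqrt_mul (by positivity), mul_comm]
  congr 1
  rw [Real.sqrt_eq_rpow, Real.sqrt_eq_rpow, ← Real.rpow_natCast, ← Real.rpow_natCast,
    ← Real.rpow_mul (by positivity), ← Real.rpow_mul (by positivity), mul_comm (1 / 2 : ℝ)]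
  congr 1
  ring

lemma polyMoment_update_sub {C : Matrix ι ι ℝ} (hC : C.PosDef) (P : ι → Polynomial ℝ) (i : ι)
    (p q : Polynomial ℝ) :
    polyMoment C (Function.update P i (p - q)) =
      polyMoment C (Function.update P i p) - polyMoment C (Function.update P i q) := by
  unfold polyMoment
  rw [← integral_sub (integrable_prod_eval_mul_gaussianWeight hC _)
    (integrable_prod_eval_mul_gaussianWeight hC _)]
  simp only [prod_eval_update, Polynomial.eval_sub, sub_mul]

lemma polyMoment_update_smul (C : Matrix ι ι ℝ) (P : ι → Polynomial ℝ) (i : ι)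
    (c : ℝ) (p : Polynomial ℝ) :
    polyMoment C (Function.update P i (c • p)) = c * polyMoment C (Function.update P i p) := by
  unfold polyMoment
  rw [← integral_const_mul]
  simp only [prod_eval_update, Polynomial.eval_smul, smul_eq_mul, mul_assoc]

/-- The probabilist Hermite polynomials with real coefficients. -/
noncomputable def realHermite (n : ℕ) : Polynomial ℝ :=
  (Polynomial.hermite n).map (Int.castRingHom ℝ)

lemma realHermite_succ (n : ℕ) :
    realHermite (n + 1) = Polynomial.X * realHermite n - (realHermite n).derivative := by
  simp [realHermite, Polynomial.hermite_succ, Polynomial.derivative_map]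

lemma derivative_realHermite_succ (n : ℕ) :
    (realHermite (n + 1)).derivative = ((n + 1 : ℕ) : ℝ) • realHermite n := by
  induction n with
  | zero => simp [realHermite]
  | succ m ih =>
    rw [realHermite_succ (m + 1), Polynomial.derivative_sub, Polynomial.derivative_mul, ih,
      Polynomial.derivative_smul, realHermite_succ m]
    simp only [Polynomial.derivative_X, Polynomial.smul_eq_C_mul]
    push_cast
    simp only [map_add, map_one]
    ring

lemma derivative_realHermite (n : ℕ) :
    (realHermite n).derivative = (n : ℝ) • realHermite (n - 1) := by
  cases n with
  | zero => simp [realHermite]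
  | succ n => simpa using derivative_realHermite_succ n

/-- The normalised Gaussian moment of a product of Hermite polynomials in the coordinates. -/
noncomputable def hermiteMoment (C : Matrix ι ι ℝ) (n : ι → ℕ) : ℝ :=
  (√((2 * π) ^ Fintype.card ι * C.det))⁻¹ * polyMoment C (fun i => realHermite (n i))

lemma hermiteMoment_zero {C : Matrix ι ι ℝ} (hC : C.PosDef) : hermiteMoment C 0 = 1 := by
  have hdet := hC.det_pos
  have h : polyMoment C (fun _ : ι => realHermite 0) = √((2 * π) ^ Fintype.card ι * C.det) := by
    rw [← integral_gaussianWeight hC]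
    simp [polyMoment, realHermite]
  have hpos : 0 < √((2 * π) ^ Fintype.card ι * C.det) := by positivity
  simp only [hermiteMoment, Pi.zero_apply, h]
  rw [inv_mul_cancel₀ (ne_of_gt hpos)]

/-- Wick recursion: a leg at site `i` is contracted with the legs at the other sites. -/
lemma hermiteMoment_update_succ {C : Matrix ι ι ℝ} (hC : C.PosDef) {i : ι} (hi : C i i = 1)
    (n : ι → ℕ) :
    hermiteMoment C (Function.update n i (n i + 1)) =
      ∑ j ∈ Finset.univ.erase i, C i j * n j * hermiteMoment C (Function.update n j (n j - 1)) := by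
  have hupd (j : ι) (m : ℕ) : (fun k => realHermite (Function.update n j m k)) =
      Function.update (fun k => realHermite (n k)) j (realHermite m) :=
    Function.comp_update realHermite n j m
  have key := polyMoment_update_X_mul hC (fun k => realHermite (n k)) i
  rw [← Finset.add_sum_erase _ _ (Finset.mem_univ i), hi, one_mul, ← sub_eq_iff_eq_add',
    ← polyMoment_update_sub hC, ← realHermite_succ] at key
  simp only [hermiteMoment, hupd, key, Finset.mul_sum, derivative_realHermite,
    polyMoment_update_smul]
  exact Finset.sum_congr rfl fun j _ => by ring

end Gaussian

section FourSites

variable {C : Matrix (Fin 4) (Fin 4) ℝ}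

lemma update_vecFour {α : Type*} (k l m n p : α) :
    Function.update ![k, l, m, n] 0 p = ![p, l, m, n] ∧
      Function.update ![k, l, m, n] 1 p = ![k, p, m, n] ∧
      Function.update ![k, l, m, n] 2 p = ![k, l, p, n] ∧
      Function.update ![k, l, m, n] 3 p = ![k, l, m, p] := by
  refine ⟨?_, ?_, ?_, ?_⟩ <;> ext i <;> fin_cases i <;> rfl

lemma hermiteMoment_succ_zero (hC : C.PosDef) (hdiag : ∀ i, C i i = 1) (k l m n : ℕ) :
    hermiteMoment C ![k + 1, l, m, n] = C 0 1 * l * hermiteMoment C ![k, l - 1, m, n] +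
      C 0 2 * m * hermiteMoment C ![k, l, m - 1, n] +
      C 0 3 * n * hermiteMoment C ![k, l, m, n - 1] := by
  have h := hermiteMoment_update_succ hC (hdiag 0) ![k, l, m, n]
  have he : Finset.univ.erase (0 : Fin 4) = {1, 2, 3} := by decide
  simpa [he, add_assoc, update_vecFour] using h

lemma hermiteMoment_succ_one (hC : C.PosDef) (hdiag : ∀ i, C i i = 1) (l m n : ℕ) :
    hermiteMoment C ![0, l + 1, m, n] = C 1 2 * m * hermiteMoment C ![0, l, m - 1, n] +
      C 1 3 * n * hermiteMoment C ![0, l, m, n - 1] := by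
  have h := hermiteMoment_update_succ hC (hdiag 1) ![0, l, m, n]
  have he : Finset.univ.erase (1 : Fin 4) = {0, 2, 3} := by decide
  simpa [he, add_assoc, update_vecFour] using h

lemma hermiteMoment_succ_two (hC : C.PosDef) (hdiag : ∀ i, C i i = 1) (m n : ℕ) :
    hermiteMoment C ![0, 0, m + 1, n] = C 2 3 * n * hermiteMoment C ![0, 0, m, n - 1] := by
  have h := hermiteMoment_update_succ hC (hdiag 2) ![0, 0, m, n]
  have he : Finset.univ.erase (2 : Fin 4) = {0, 1, 3} := by decide
  simpa [he, update_vecFour] using h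

lemma hermiteMoment_succ_three (hC : C.PosDef) (hdiag : ∀ i, C i i = 1) (n : ℕ) :
    hermiteMoment C ![0, 0, 0, n + 1] = 0 := by
  have h := hermiteMoment_update_succ hC (hdiag 3) ![0, 0, 0, n]
  have he : Finset.univ.erase (3 : Fin 4) = {0, 1, 2} := by decide
  simpa [he, update_vecFour] using h

lemma hermiteMoment_zero_four (hC : C.PosDef) : hermiteMoment C ![0, 0, 0, 0] = 1 := by
  rw [← hermiteMoment_zero hC]
  congr 1
  ext i
  fin_cases i <;> rfl

lemma add_mul_sq_sub_one_eq_sum_realHermite (a y : ℝ) :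
    y + a * (y ^ 2 - 1) = ∑ k : Fin 2, a ^ (k : ℕ) * (realHermite (k + 1)).eval y := by
  have h1 : realHermite 1 = Polynomial.X := by simp [realHermite]
  have h2 : realHermite 2 = Polynomial.X ^ 2 - 1 := by
    rw [realHermite_succ 1, h1, Polynomial.derivative_X, sq]
  simp [h1, h2]

lemma integral_prod_activation (hC : C.PosDef) (a : ℝ) :
    ∫ x : Fin 4 → ℝ, (∏ i, (x i + a * (x i ^ 2 - 1))) *
        ((√((2 * π) ^ 4 * C.det))⁻¹ * Real.exp (-(x ⬝ᵥ C⁻¹ *ᵥ x) / 2)) =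
      ∑ s : Fin 4 → Fin 2, (∏ i, a ^ (s i : ℕ)) * hermiteMoment C (fun i => s i + 1) := by
  have h (x : Fin 4 → ℝ) : (∏ i, (x i + a * (x i ^ 2 - 1))) *
        ((√((2 * π) ^ 4 * C.det))⁻¹ * Real.exp (-(x ⬝ᵥ C⁻¹ *ᵥ x) / 2)) =
      ∑ s : Fin 4 → Fin 2, ((∏ i, a ^ (s i : ℕ)) * (√((2 * π) ^ 4 * C.det))⁻¹) *
        ((∏ i, (realHermite (s i + 1)).eval (x i)) * gaussianWeight C x) := by
    simp only [add_mul_sq_sub_one_eq_sum_realHermite, Fintype.prod_sum, Finset.prod_mul_distrib,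
      Finset.sum_mul, gaussianWeight]
    exact Finset.sum_congr rfl fun s _ => by ring
  simp only [h]
  rw [integral_finsetSum _ fun s _ =>
    (integrable_prod_eval_mul_gaussianWeight hC _).const_mul _]
  simp only [integral_const_mul, hermiteMoment, polyMoment, Fintype.card_fin, mul_assoc]

lemma sum_fin_succ_pi {α : Type*} [Fintype α] {n : ℕ} (f : (Fin (n + 1) → α) → ℝ) :
    ∑ s, f s = ∑ i, ∑ t : Fin n → α, f (vecCons i t) := by
  rw [← (Fin.consEquiv fun _ => α).sum_comp, Fintype.sum_prod_type]
  rfl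

end FourSites

/-- Wick computation of the connected fourth moment of
σ(h^μ) = h^μ + a((h^μ)²-1) for a centered Gaussian vector h with covariance C
having unit diagonal, compared to the Gaussian prediction via the kernel
K_μν = C_μν + 2a²C_μν². -/
theorem quartic_moment_quadratic_activation
    (a : ℝ) (C : Matrix (Fin 4) (Fin 4) ℝ) (hC : C.PosDef) (hdiag : ∀ i, C i i = 1) :
    let σ : ℝ → ℝ := fun x => x + a * (x ^ 2 - 1)
    let K : Fin 4 → Fin 4 → ℝ := fun μ ν => C μ ν + 2 * a ^ 2 * (C μ ν) ^ 2
    (∫ x : Fin 4 → ℝ,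
        (σ (x 0) * σ (x 1) * σ (x 2) * σ (x 3)) *
          ((Real.sqrt ((2 * π) ^ 4 * C.det))⁻¹ * Real.exp (-(x ⬝ᵥ C⁻¹ *ᵥ x) / 2)))
      - (K 0 1 * K 2 3 + K 0 2 * K 1 3 + K 0 3 * K 1 2)
    = 16 * a ^ 4 *
        (C 0 1 * C 0 2 * C 1 3 * C 2 3 + C 0 1 * C 0 3 * C 1 2 * C 2 3 +
          C 0 2 * C 0 3 * C 1 2 * C 1 3)
      + 4 * a ^ 2 *
        (C 0 1 * C 0 2 * C 1 3 + C 0 1 * C 0 2 * C 2 3 + C 0 1 * C 0 3 * C 1 2 +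
         C 0 1 * C 0 3 * C 2 3 + C 0 1 * C 1 2 * C 2 3 + C 0 1 * C 1 3 * C 2 3 +
         C 0 2 * C 0 3 * C 1 2 + C 0 2 * C 0 3 * C 1 3 + C 0 2 * C 1 2 * C 1 3 +
         C 0 2 * C 1 3 * C 2 3 + C 0 3 * C 1 2 * C 1 3 + C 0 3 * C 1 2 * C 2 3) := by
  intro σ K
  have hprod (x : Fin 4 → ℝ) : σ (x 0) * σ (x 1) * σ (x 2) * σ (x 3) =
      ∏ i, (x i + a * (x i ^ 2 - 1)) := by
    rw [Fin.prod_univ_four]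
  have hvec (i j k l : Fin 2) : (fun r : Fin 4 => ((![i, j, k, l] r : Fin 2) : ℕ) + 1) =
      ![(i : ℕ) + 1, (j : ℕ) + 1, (k : ℕ) + 1, (l : ℕ) + 1] := by
    ext r
    fin_cases r <;> rfl
  simp only [hprod]
  rw [integral_prod_activation hC]
  simp only [sum_fin_succ_pi, Fintype.sum_unique, Matrix.empty_eq, hvec, Fin.sum_univ_two,
    Fin.prod_univ_four]
  simp [hermiteMoment_succ_zero hC hdiag, hermiteMoment_succ_one hC hdiag,
    hermiteMoment_succ_two hC hdiag, hermiteMoment_succ_three hC hdiag,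
    hermiteMoment_zero_four hC]
  simp only [K]
  ring
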